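/- Let J = Z−. Suppose the diagonal system x(n+1) = diag(A11(n), A22(n)) x(n) admits an exponential dichotomy on Z− and sup_{n∈Z−\{0}} ‖A12(n)‖ < +∞. Then the triangular system x(n+1) = (A11(n) A12(n); 0 A22(n)) x(n) admits an exponential dichotomy on Z−. -/

import Mathlib

open Real ContinuousLinearMap

noncomputable section

universe u

variable {X : Type u} [NormedAddCommGroup X] [NormedSpace ℝ X]

/-- The cocycle associated with the system `x(n+1) = A(n) x(n)`, as a function of the
number of steps: `cocycleAux A n k = A(n+k-1) ∘ ⋯ ∘ A(n)`. -/
def cocycleAux (A : ℤ → X →L[ℝ] X) (n : ℤ) : ℕ → (X →L[ℝ] X)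
  | 0 => ContinuousLinearMap.id ℝ X
  | k + 1 => (A (n + k)).comp (cocycleAux A n k)

/-- The cocycle `Φ(m, n) = A(m-1) ⋯ A(n)` for `m > n`, and `Φ(n, n) = Id`. -/
def Phi (A : ℤ → X →L[ℝ] X) (m n : ℤ) : X →L[ℝ] X :=
  cocycleAux A n (m - n).toNat

/-- The system `x(n+1) = A(n) x(n)`, `n ∈ J'`, admits an exponential dichotomy on `J`
with respect to the family of (bounded) projections `P(n)`, `n ∈ J`:
there are constants `K, α > 0` such that
(i) `P(n)` are projections, `A(n) P(n) = P(n+1) A(n)` for `n ∈ J'`, and `A(n)` maps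
`ker P(n)` bijectively onto `ker P(n+1)` for `n ∈ J'`;
(ii) `‖Φ(m,n) P(n)‖ ≤ K e^{-α (m-n)}` for `m ≥ n` in `J`;
(iii) `‖Φ(m,n) (Id - P(n))‖ ≤ K e^{-α (n-m)}` for `m ≤ n` in `J`, where
`Φ(m,n) : ker P(n) → ker P(m)` denotes the inverse of `Φ(n,m)` restricted to `ker P(m)`;
the latter is phrased as: whenever `x ∈ ker P(m)` and `Φ(n,m) x = (Id - P(n)) y`,
then `‖x‖ ≤ K e^{-α (n-m)} ‖y‖`. -/
def IsExpDichotomy (J J' : Set ℤ) (A P : ℤ → X →L[ℝ] X) : Prop :=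
  ∃ K α : ℝ, 0 < K ∧ 0 < α ∧
    (∀ n ∈ J, (P n).comp (P n) = P n) ∧
    (∀ n ∈ J', (A n).comp (P n) = (P (n + 1)).comp (A n)) ∧
    (∀ n ∈ J', Set.BijOn (A n) {x : X | P n x = 0} {x : X | P (n + 1) x = 0}) ∧
    (∀ m n : ℤ, m ∈ J → n ∈ J → n ≤ m →
      ‖(Phi A m n).comp (P n)‖ ≤ K * Real.exp (-α * ((m : ℝ) - (n : ℝ)))) ∧
    (∀ m n : ℤ, m ∈ J → n ∈ J → m ≤ n → ∀ x y : X,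
      P m x = 0 → Phi A n m x = y - P n y →
      ‖x‖ ≤ K * Real.exp (-α * ((n : ℝ) - (m : ℝ))) * ‖y‖)

/-- The system `x(n+1) = A(n) x(n)`, `n ∈ J'`, admits an exponential dichotomy on `J`. -/
def ExpDichotomy (J J' : Set ℤ) (A : ℤ → X →L[ℝ] X) : Prop :=
  ∃ P : ℤ → X →L[ℝ] X, IsExpDichotomy J J' A P

/-- A subspace (given as a set) `S` of `X` is complemented: there is a closed subspace `Z`
of `X` with `X = S ⊕ Z`. -/
def IsComplementedSubspace (S : Set X) : Prop :=
  ∃ Z : Submodule ℝ X, IsClosed (Z : Set X) ∧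
    (∀ v ∈ S, v ∈ Z → v = (0 : X)) ∧ ∀ v : X, ∃ s ∈ S, ∃ z ∈ Z, v = s + z

/-- The subspace `S = {v : sup_{n ∈ ℤ⁺} ‖Φ(n,0) v‖ < ∞}` of initial conditions of bounded
forward solutions. -/
def Sset (A : ℤ → X →L[ℝ] X) : Set X :=
  {v : X | ∃ C : ℝ, ∀ n : ℤ, 0 ≤ n → ‖Phi A n 0 v‖ ≤ C}

/-- The subspace `U(m)` of all `v` for which there is a bounded sequence `(x(n))_{n ≤ m}`
with `x(m) = v` and `x(n) = A(n-1) x(n-1)` for `n ≤ m`. -/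
def Uset (A : ℤ → X →L[ℝ] X) (m : ℤ) : Set X :=
  {v : X | ∃ x : ℤ → X, x m = v ∧ (∃ C : ℝ, ∀ n : ℤ, n ≤ m → ‖x n‖ ≤ C) ∧
    ∀ n : ℤ, n ≤ m → x n = A (n - 1) (x (n - 1))}

variable {X1 : Type u} {X2 : Type u} [NormedAddCommGroup X1] [NormedSpace ℝ X1]
  [NormedAddCommGroup X2] [NormedSpace ℝ X2]

/-- The triangular system operator `(x1, x2) ↦ (A11(n) x1 + A12(n) x2, A22(n) x2)`. -/
def triangular (A11 : ℤ → X1 →L[ℝ] X1) (A12 : ℤ → X2 →L[ℝ] X1)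
    (A22 : ℤ → X2 →L[ℝ] X2) (n : ℤ) : (X1 × X2) →L[ℝ] X1 × X2 :=
  (((A11 n).comp (fst ℝ X1 X2)) + ((A12 n).comp (snd ℝ X1 X2))).prod
    ((A22 n).comp (snd ℝ X1 X2))

/-- The diagonal system operator `(x1, x2) ↦ (A11(n) x1, A22(n) x2)`. -/
def diagonal (A11 : ℤ → X1 →L[ℝ] X1) (A22 : ℤ → X2 →L[ℝ] X2) (n : ℤ) :
    (X1 × X2) →L[ℝ] X1 × X2 :=
  (A11 n).prodMap (A22 n)

/-- Backward product: `levelProd A i k = A i ∘ A (i + 1) ∘ ⋯ ∘ A (i + k - 1)`, for maps `A i`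
leading from level `i + 1` to level `i`. -/
def levelProd {E : Type*} [NormedAddCommGroup E] [NormedSpace ℝ E] (A : ℕ → E →L[ℝ] E)
    (i : ℕ) : ℕ → E →L[ℝ] E
  | 0 => ContinuousLinearMap.id ℝ E
  | k + 1 => (A i).comp (levelProd A (i + 1) k)

/-- An exponential dichotomy on the nonpositive half-line, with time `-i` written as level `i`. -/
structure LevelDichotomy {E : Type*} [NormedAddCommGroup E] [NormedSpace ℝ E]
    (A P : ℕ → E →L[ℝ] E) (K r : ℝ) : Prop where
  K_pos : 0 < K
  r_pos : 0 < r
  r_lt_one : r < 1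
  idem : ∀ i x, P i (P i x) = P i x
  comm : ∀ i x, A i (P (i + 1) x) = P i (A i x)
  surj : ∀ i y, P i y = 0 → ∃ x, P (i + 1) x = 0 ∧ A i x = y
  stable : ∀ i k x, ‖levelProd A i k (P (i + k) x)‖ ≤ K * r ^ k * ‖x‖
  unstable : ∀ i k x, P (i + k) x = 0 → ‖x‖ ≤ K * r ^ k * ‖levelProd A i k x‖

section LevelDichotomy

variable {E : Type*} [NormedAddCommGroup E] [NormedSpace ℝ E]

@[simp] lemma levelProd_zero (A : ℕ → E →L[ℝ] E) (i : ℕ) (x : E) :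
    levelProd A i 0 x = x := rfl

lemma levelProd_succ (A : ℕ → E →L[ℝ] E) (i k : ℕ) (x : E) :
    levelProd A i (k + 1) x = A i (levelProd A (i + 1) k x) := rfl

lemma levelProd_succ' (A : ℕ → E →L[ℝ] E) (i k : ℕ) (x : E) :
    levelProd A i (k + 1) x = levelProd A i k (A (i + k) x) := by
  induction k generalizing i with
  | zero => rfl
  | succ k ih =>
    rw [levelProd_succ, ih, levelProd_succ, show i + 1 + k = i + (k + 1) by omega]

lemma cocycleAux_eq_levelProd (A : ℤ → E →L[ℝ] E) (i k : ℕ) :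
    cocycleAux A (-((i + k : ℕ) : ℤ)) k
      = levelProd (fun j : ℕ => A (-((j + 1 : ℕ) : ℤ))) i k := by
  induction k generalizing i with
  | zero => rfl
  | succ k ih =>
    have h1 : -((i + (k + 1) : ℕ) : ℤ) + k = -((i + 1 : ℕ) : ℤ) := by push_cast; ring
    have h2 : i + (k + 1) = i + 1 + k := by omega
    rw [cocycleAux, h1, h2, ih]
    rfl

lemma Phi_eq_levelProd (A : ℤ → E →L[ℝ] E) (i k : ℕ) :
    Phi A (-(i : ℤ)) (-((i + k : ℕ) : ℤ))
      = levelProd (fun j : ℕ => A (-((j + 1 : ℕ) : ℤ))) i k := by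
  rw [← cocycleAux_eq_levelProd, Phi]
  congr 1
  push_cast
  omega

namespace LevelDichotomy

variable {A P : ℕ → E →L[ℝ] E} {K r : ℝ}

lemma levelProd_comm (h : LevelDichotomy A P K r) (i k : ℕ) (x : E) :
    levelProd A i k (P (i + k) x) = P i (levelProd A i k x) := by
  induction k generalizing i with
  | zero => rfl
  | succ k ih =>
    rw [levelProd_succ, levelProd_succ, ← h.comm, ← ih, show i + 1 + k = i + (k + 1) by omega]

lemma levelProd_surj (h : LevelDichotomy A P K r) (i k : ℕ) (y : E) (hy : P i y = 0) :
    ∃ x, P (i + k) x = 0 ∧ levelProd A i k x = y := by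
  induction k with
  | zero => exact ⟨y, hy, rfl⟩
  | succ k ih =>
    obtain ⟨x, hx, rfl⟩ := ih
    obtain ⟨z, hz, rfl⟩ := h.surj _ _ hx
    exact ⟨z, hz, levelProd_succ' A i k z⟩

lemma eq_of_levelProd_eq (h : LevelDichotomy A P K r) (i k : ℕ) {x y : E}
    (hx : P (i + k) x = 0) (hy : P (i + k) y = 0)
    (hxy : levelProd A i k x = levelProd A i k y) : x = y := by
  have := h.unstable i k (x - y) (by rw [map_sub, hx, hy, sub_zero])
  rw [map_sub, hxy, sub_self, norm_zero, mul_zero] at this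
  exact sub_eq_zero.1 (norm_le_zero_iff.1 this)

lemma norm_proj_le (h : LevelDichotomy A P K r) (i : ℕ) (x : E) : ‖P i x‖ ≤ K * ‖x‖ := by
  simpa using h.stable i 0 x

lemma norm_sub_proj_le (h : LevelDichotomy A P K r) (i : ℕ) (x : E) :
    ‖x - P i x‖ ≤ (1 + K) * ‖x‖ := by
  linarith [norm_sub_le x (P i x), h.norm_proj_le i x]

lemma proj_sub_proj (h : LevelDichotomy A P K r) (i : ℕ) (x : E) : P i (x - P i x) = 0 := by
  rw [map_sub, h.idem, sub_self]

/-- The inverse of the dynamics along the unstable directions, as bounded operators. -/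
lemma exists_unstable_inverse (h : LevelDichotomy A P K r) :
    ∃ G : ℕ → ℕ → E →L[ℝ] E, (∀ i k y, P (i + k) (G i k y) = 0) ∧
      (∀ i k y, levelProd A i k (G i k y) = y - P i y) ∧
      (∀ i k y, ‖G i k y‖ ≤ K * (1 + K) * r ^ k * ‖y‖) := by
  have key : ∀ i k, ∃ g : E →L[ℝ] E, (∀ y, P (i + k) (g y) = 0) ∧
      (∀ y, levelProd A i k (g y) = y - P i y) ∧
      (∀ y, ‖g y‖ ≤ K * (1 + K) * r ^ k * ‖y‖) := by
    intro i k
    have hex := fun y => h.levelProd_surj i k (y - P i y) (h.proj_sub_proj i y)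
    choose g hg1 hg2 using hex
    have hbound : ∀ y, ‖g y‖ ≤ K * (1 + K) * r ^ k * ‖y‖ := by
      intro y
      have hK := h.K_pos
      have hr := h.r_pos
      calc ‖g y‖ ≤ K * r ^ k * ‖levelProd A i k (g y)‖ := h.unstable i k _ (hg1 y)
        _ ≤ K * r ^ k * ((1 + K) * ‖y‖) := by
          rw [hg2]
          gcongr
          exact h.norm_sub_proj_le i y
        _ = _ := by ring
    let gl : E →ₗ[ℝ] E :=
      { toFun := g
        map_add' := fun x y => h.eq_of_levelProd_eq i k (hg1 _)
          (by rw [map_add, hg1, hg1, add_zero])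
          (by rw [map_add, hg2, hg2, hg2, map_add]; abel)
        map_smul' := fun c x => h.eq_of_levelProd_eq i k (hg1 _)
          (by rw [map_smul, hg1, smul_zero])
          (by rw [map_smul, hg2, hg2, map_smul, RingHom.id_apply, smul_sub]) }
    exact ⟨gl.mkContinuous _ hbound, hg1, hg2, hbound⟩
  choose G h1 h2 h3 using key
  exact ⟨G, h1, h2, h3⟩

/-- Uniformly bounded changes of variables preserve exponential dichotomies. -/
lemma conj (h : LevelDichotomy A P K r) {A' T T' : ℕ → E →L[ℝ] E} {τ : ℝ} (hτ : 0 < τ)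
    (hT'T : ∀ i x, T' i (T i x) = x) (hTT' : ∀ i x, T i (T' i x) = x)
    (hT : ∀ i x, ‖T i x‖ ≤ τ * ‖x‖) (hT' : ∀ i x, ‖T' i x‖ ≤ τ * ‖x‖)
    (hA : ∀ i x, A' i (T (i + 1) x) = T i (A i x)) :
    LevelDichotomy A' (fun i => (T i).comp ((P i).comp (T' i))) (τ * K * τ) r := by
  have hK := h.K_pos
  have hr := h.r_pos
  have hprod : ∀ i k x, levelProd A' i k (T (i + k) x) = T i (levelProd A i k x) := by
    intro i k x
    induction k generalizing i with
    | zero => rfl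
    | succ k ih =>
      rw [levelProd_succ, levelProd_succ, ← hA, ← ih, show i + 1 + k = i + (k + 1) by omega]
  have hker : ∀ i x, T i (P i (T' i x)) = 0 → P i (T' i x) = 0 := by
    intro i x hx
    rw [← hT'T i (P i (T' i x)), hx, map_zero]
  refine ⟨by positivity, hr, h.r_lt_one, ?_, ?_, ?_, ?_, ?_⟩
  · intro i x
    simp [hT'T, h.idem]
  · intro i x
    have : A' i x = T i (A i (T' (i + 1) x)) := by rw [← hA, hTT']
    simp [this, hT'T, hA, h.comm]
  · intro i y hy
    obtain ⟨x, hx, hxy⟩ := h.surj i (T' i y) (hker i y hy)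
    exact ⟨T (i + 1) x, by simp [hT'T, hx], by rw [hA, hxy, hTT']⟩
  · intro i k x
    calc ‖levelProd A' i k (T (i + k) (P (i + k) (T' (i + k) x)))‖
        = ‖T i (levelProd A i k (P (i + k) (T' (i + k) x)))‖ := by rw [hprod]
      _ ≤ τ * (K * r ^ k * (τ * ‖x‖)) := by
        refine (hT _ _).trans ?_
        gcongr
        refine (h.stable _ _ _).trans ?_
        gcongr
        exact hT' _ _
      _ = _ := by ring
  · intro i k x hx
    have h1 := h.unstable i k _ (hker _ x hx)
    have h2 : levelProd A i k (T' (i + k) x) = T' i (levelProd A' i k x) := by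
      conv_rhs => rw [← hTT' (i + k) x, hprod, hT'T]
    calc ‖x‖ = ‖T (i + k) (T' (i + k) x)‖ := by rw [hTT']
      _ ≤ τ * (K * r ^ k * (τ * ‖levelProd A' i k x‖)) := by
        refine (hT _ _).trans ?_
        gcongr
        refine h1.trans ?_
        rw [h2]
        gcongr
        exact hT' _ _
      _ = _ := by ring

end LevelDichotomy

lemma IsExpDichotomy.levelDichotomy {A P : ℤ → E →L[ℝ] E}
    (h : IsExpDichotomy {n : ℤ | n ≤ 0} {n : ℤ | n ≤ -1} A P) :
    ∃ K r, LevelDichotomy (fun i : ℕ => A (-((i + 1 : ℕ) : ℤ))) (fun i : ℕ => P (-(i : ℤ))) K r := by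
  obtain ⟨K, α, hK, hα, hidem, hcomm, hbij, hst, hun⟩ := h
  have hstep : ∀ i : ℕ, -((i + 1 : ℕ) : ℤ) + 1 = -(i : ℤ) := by intro i; push_cast; ring
  have hJ : ∀ i : ℕ, -(i : ℤ) ∈ {n : ℤ | n ≤ 0} := by intro i; simp
  have hJ' : ∀ i : ℕ, -((i + 1 : ℕ) : ℤ) ∈ {n : ℤ | n ≤ -1} := by
    intro i; simp only [Set.mem_ofPred_eq]; push_cast; omega
  have hexp : ∀ i k : ℕ,
      Real.exp (-α * (((-(i : ℤ) : ℤ) : ℝ) - ((-((i + k : ℕ) : ℤ) : ℤ) : ℝ)))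
        = Real.exp (-α) ^ k := by
    intro i k
    rw [← Real.exp_nat_mul]
    congr 1
    push_cast
    ring
  have hcomm' : ∀ (i : ℕ) (x : E), A (-((i + 1 : ℕ) : ℤ)) (P (-((i + 1 : ℕ) : ℤ)) x)
      = P (-(i : ℤ)) (A (-((i + 1 : ℕ) : ℤ)) x) := by
    intro i x
    have := hcomm _ (hJ' i)
    rw [hstep] at this
    exact congrArg (fun f => f x) this
  refine ⟨K, Real.exp (-α), hK, Real.exp_pos _, by simpa using hα, ?_, hcomm', ?_, ?_, ?_⟩
  · exact fun i x => congrArg (fun f => f x) (hidem _ (hJ i))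
  · intro i y hy
    have := (hbij _ (hJ' i)).surjOn
    rw [hstep] at this
    exact this hy
  · intro i k x
    have := hst (-(i : ℤ)) (-((i + k : ℕ) : ℤ)) (hJ i) (hJ _) (by push_cast; omega)
    rw [hexp, Phi_eq_levelProd] at this
    exact ContinuousLinearMap.le_of_opNorm_le _ this x
  · intro i k x hx
    have hPx : ∀ k : ℕ, ∀ i : ℕ, P (-((i + k : ℕ) : ℤ)) x = 0 →
        P (-(i : ℤ)) (levelProd (fun j : ℕ => A (-((j + 1 : ℕ) : ℤ))) i k x) = 0 := by
      intro k
      induction k with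
      | zero => exact fun i hx => hx
      | succ k ih =>
        intro i hx
        rw [levelProd_succ, ← hcomm', ih (i + 1), map_zero]
        rwa [show i + 1 + k = i + (k + 1) by omega]
    have := hun (-((i + k : ℕ) : ℤ)) (-(i : ℤ)) (hJ _) (hJ i) (by push_cast; omega) x
      (levelProd (fun j : ℕ => A (-((j + 1 : ℕ) : ℤ))) i k x) hx
      (by rw [Phi_eq_levelProd, hPx k i hx, sub_zero])
    rwa [hexp] at this

lemma LevelDichotomy.expDichotomy {A : ℤ → E →L[ℝ] E} {P : ℕ → E →L[ℝ] E} {K r : ℝ}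
    (h : LevelDichotomy (fun i : ℕ => A (-((i + 1 : ℕ) : ℤ))) P K r) :
    ExpDichotomy {n : ℤ | n ≤ 0} {n : ℤ | n ≤ -1} A := by
  have hK := h.K_pos
  have hr := h.r_pos
  have hJ : ∀ n : ℤ, n ∈ {n : ℤ | n ≤ 0} → ∃ i : ℕ, n = -(i : ℤ) := by
    intro n hn
    exact ⟨(-n).toNat, by simp only [Set.mem_ofPred_eq] at hn; omega⟩
  have hJ' : ∀ n : ℤ, n ∈ {n : ℤ | n ≤ -1} → ∃ i : ℕ, n = -((i + 1 : ℕ) : ℤ) := by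
    intro n hn
    exact ⟨(-n - 1).toNat, by simp only [Set.mem_ofPred_eq] at hn; push_cast; omega⟩
  have hstep : ∀ i : ℕ, -((i + 1 : ℕ) : ℤ) + 1 = -(i : ℤ) := by intro i; push_cast; ring
  have hP : ∀ i : ℕ, P (-(-(i : ℤ))).toNat = P i := by intro i; simp
  have hpair : ∀ m n : ℤ, m ∈ {n : ℤ | n ≤ 0} → n ∈ {n : ℤ | n ≤ 0} → n ≤ m →
      ∃ i k : ℕ, m = -(i : ℤ) ∧ n = -((i + k : ℕ) : ℤ) := by
    intro m n hm hn hnm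
    simp only [Set.mem_ofPred_eq] at hm hn
    exact ⟨(-m).toNat, (m - n).toNat, by omega, by push_cast; omega⟩
  have hexp : ∀ i k : ℕ,
      Real.exp (-(-Real.log r) * (((-(i : ℤ) : ℤ) : ℝ) - ((-((i + k : ℕ) : ℤ) : ℤ) : ℝ)))
        = r ^ k := by
    intro i k
    rw [← Real.exp_log (pow_pos hr k), Real.log_pow]
    congr 1
    push_cast
    ring
  have hle : K ≤ K * (1 + K) := by nlinarith
  refine ⟨fun n => P (-n).toNat, K * (1 + K), -Real.log r, by positivity,
    neg_pos.2 (Real.log_neg hr h.r_lt_one), ?_, ?_, ?_, ?_, ?_⟩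
  · intro n hn
    ext x
    exact h.idem _ x
  · intro n hn
    obtain ⟨i, rfl⟩ := hJ' n hn
    simp only [hstep, hP]
    ext x
    exact h.comm i x
  · intro n hn
    obtain ⟨i, rfl⟩ := hJ' n hn
    simp only [hstep, hP]
    refine ⟨?_, ?_, ?_⟩
    · intro x hx
      simp only [Set.mem_ofPred_eq] at hx ⊢
      rw [← h.comm i x, hx, map_zero]
    · intro x hx y hy hxy
      exact h.eq_of_levelProd_eq i 1 hx hy hxy
    · intro y hy
      exact h.surj i y hy
  · intro m n hm hn hnm
    obtain ⟨i, k, rfl, rfl⟩ := hpair m n hm hn hnm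
    rw [hexp, Phi_eq_levelProd]
    simp only [hP]
    refine ContinuousLinearMap.opNorm_le_bound _ (by positivity) fun x => ?_
    refine (h.stable i k x).trans ?_
    gcongr
  · intro n m hn hm hnm x y hx hxy
    obtain ⟨i, k, rfl, rfl⟩ := hpair m n hm hn hnm
    rw [Phi_eq_levelProd] at hxy
    simp only [hP] at hx hxy
    rw [hexp]
    calc ‖x‖ ≤ K * r ^ k * ‖y - P i y‖ := hxy ▸ h.unstable i k x hx
      _ ≤ K * r ^ k * ((1 + K) * ‖y‖) := by
        gcongr
        exact h.norm_sub_proj_le i y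
      _ = _ := by ring

end LevelDichotomy

section Diagonal

variable {E₁ E₂ : Type*} [NormedAddCommGroup E₁] [NormedSpace ℝ E₁]
  [NormedAddCommGroup E₂] [NormedSpace ℝ E₂]

lemma levelProd_prodMap (A₁ : ℕ → E₁ →L[ℝ] E₁) (A₂ : ℕ → E₂ →L[ℝ] E₂) (i k : ℕ) (x : E₁ × E₂) :
    levelProd (fun i => (A₁ i).prodMap (A₂ i)) i k x
      = (levelProd A₁ i k x.1, levelProd A₂ i k x.2) := by
  induction k generalizing i with
  | zero => rfl
  | succ k ih => rw [levelProd_succ, ih]; rfl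

namespace LevelDichotomy

variable {A₁ : ℕ → E₁ →L[ℝ] E₁} {A₂ : ℕ → E₂ →L[ℝ] E₂} {P : ℕ → E₁ × E₂ →L[ℝ] E₁ × E₂} {K r : ℝ}

/-- The unstable subspaces of a diagonal system are products. -/
lemma proj_fst_eq_zero (h : LevelDichotomy (fun i => (A₁ i).prodMap (A₂ i)) P K r) {i : ℕ}
    {x : E₁ × E₂} (hx : P i x = 0) : P i (x.1, 0) = 0 := by
  have hK := h.K_pos
  have hr := h.r_pos
  have hbound : ∀ k : ℕ, ‖P i (x.1, 0)‖ ≤ K * K * ‖x‖ * (r ^ k * r ^ k) := by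
    intro k
    obtain ⟨y, hy, hyx⟩ := h.levelProd_surj i k x hx
    have h1 : levelProd (fun i => (A₁ i).prodMap (A₂ i)) i k (y.1, 0) = (x.1, 0) := by
      rw [levelProd_prodMap] at hyx ⊢
      simp [← hyx]
    have h2 := h.unstable i k y hy
    have h3 : ‖((y.1, 0) : E₁ × E₂)‖ ≤ ‖y‖ := by
      rw [Prod.norm_mk, norm_zero, max_eq_left (norm_nonneg _)]
      exact norm_fst_le y
    calc ‖P i (x.1, 0)‖ ≤ K * r ^ k * ‖((y.1, 0) : E₁ × E₂)‖ := by
          rw [← h1, ← h.levelProd_comm]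
          exact h.stable i k _
      _ ≤ K * r ^ k * (K * r ^ k * ‖x‖) := by
          gcongr
          exact h3.trans (hyx ▸ h2)
      _ = _ := by ring
  have hlim : Filter.Tendsto (fun k : ℕ => K * K * ‖x‖ * (r ^ k * r ^ k)) Filter.atTop
      (nhds (K * K * ‖x‖ * (0 * 0))) := by
    have := tendsto_pow_atTop_nhds_zero_of_lt_one hr.le h.r_lt_one
    exact (this.mul this).const_mul _
  have := ge_of_tendsto' hlim hbound
  rw [mul_zero, mul_zero] at this
  exact norm_le_zero_iff.1 this

lemma proj_snd_eq_zero (h : LevelDichotomy (fun i => (A₁ i).prodMap (A₂ i)) P K r) {i : ℕ}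
    {x : E₁ × E₂} (hx : P i x = 0) : P i (0, x.2) = 0 := by
  have : ((0, x.2) : E₁ × E₂) = x - (x.1, 0) := by ext <;> simp
  rw [this, map_sub, hx, h.proj_fst_eq_zero hx, sub_zero]

/-- The first block of a diagonal system with a dichotomy has a dichotomy. -/
lemma fst (h : LevelDichotomy (fun i => (A₁ i).prodMap (A₂ i)) P K r) :
    LevelDichotomy A₁
      (fun i => (ContinuousLinearMap.fst ℝ E₁ E₂).comp
        ((P i).comp (ContinuousLinearMap.inl ℝ E₁ E₂))) K r := by
  have hK := h.K_pos
  have hr := h.r_pos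
  have hQ : ∀ i x, P i (x - (P i (x, 0)).1, (0 : E₂)) = 0 := by
    intro i x
    have := h.proj_fst_eq_zero (h.proj_sub_proj i (x, 0))
    simpa using this
  have hker : ∀ i x, (P i (x, (0 : E₂))).1 = 0 ↔ P i (x, (0 : E₂)) = 0 := by
    intro i x
    refine ⟨fun hx => ?_, fun hx => by rw [hx]; rfl⟩
    have := hQ i x
    rwa [hx, sub_zero] at this
  have hprod : ∀ i k x, levelProd (fun i => (A₁ i).prodMap (A₂ i)) i k (x, 0)
      = (levelProd A₁ i k x, 0) := by
    intro i k x
    rw [levelProd_prodMap, map_zero]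
  have hnorm : ∀ x : E₁, ‖((x, 0) : E₁ × E₂)‖ = ‖x‖ := by
    intro x
    rw [Prod.norm_mk, norm_zero, max_eq_left (norm_nonneg _)]
  refine ⟨hK, hr, h.r_lt_one, ?_, ?_, ?_, ?_, ?_⟩
  · intro i x
    have := (hker i _).2 (hQ i x)
    have h2 : ((x - (P i (x, 0)).1, 0) : E₁ × E₂) = (x, 0) - ((P i (x, 0)).1, 0) := by simp
    rw [h2, map_sub, Prod.fst_sub, sub_eq_zero] at this
    exact this.symm
  · intro i x
    have := congrArg Prod.fst (h.comm i (x, 0))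
    simpa using this
  · intro i y hy
    obtain ⟨x, hx, hxy⟩ := h.surj i (y, 0) ((hker i y).1 hy)
    exact ⟨x.1, (hker _ _).2 (h.proj_fst_eq_zero hx), congrArg Prod.fst hxy⟩
  · intro i k x
    have h1 := h.stable i k (x, 0)
    rw [levelProd_prodMap, hnorm] at h1
    exact (_root_.norm_fst_le _).trans h1
  · intro i k x hx
    have h1 := h.unstable i k (x, 0) ((hker _ _).1 hx)
    rwa [hprod, hnorm, hnorm] at h1

/-- The second block of a diagonal system with a dichotomy has a dichotomy. -/
lemma snd (h : LevelDichotomy (fun i => (A₁ i).prodMap (A₂ i)) P K r) :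
    LevelDichotomy A₂
      (fun i => (ContinuousLinearMap.snd ℝ E₁ E₂).comp
        ((P i).comp (ContinuousLinearMap.inr ℝ E₁ E₂))) K r := by
  have hK := h.K_pos
  have hr := h.r_pos
  have hQ : ∀ i x, P i ((0 : E₁), x - (P i (0, x)).2) = 0 := by
    intro i x
    have := h.proj_snd_eq_zero (h.proj_sub_proj i (0, x))
    simpa using this
  have hker : ∀ i x, (P i ((0 : E₁), x)).2 = 0 ↔ P i ((0 : E₁), x) = 0 := by
    intro i x
    refine ⟨fun hx => ?_, fun hx => by rw [hx]; rfl⟩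
    have := hQ i x
    rwa [hx, sub_zero] at this
  have hprod : ∀ i k x, levelProd (fun i => (A₁ i).prodMap (A₂ i)) i k (0, x)
      = (0, levelProd A₂ i k x) := by
    intro i k x
    rw [levelProd_prodMap, map_zero]
  have hnorm : ∀ x : E₂, ‖((0, x) : E₁ × E₂)‖ = ‖x‖ := by
    intro x
    rw [Prod.norm_mk, norm_zero, max_eq_right (norm_nonneg _)]
  refine ⟨hK, hr, h.r_lt_one, ?_, ?_, ?_, ?_, ?_⟩
  · intro i x
    have := (hker i _).2 (hQ i x)
    have h2 : ((0, x - (P i (0, x)).2) : E₁ × E₂) = (0, x) - (0, (P i (0, x)).2) := by simp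
    rw [h2, map_sub, Prod.snd_sub, sub_eq_zero] at this
    exact this.symm
  · intro i x
    have := congrArg Prod.snd (h.comm i (0, x))
    simpa using this
  · intro i y hy
    obtain ⟨x, hx, hxy⟩ := h.surj i (0, y) ((hker i y).1 hy)
    exact ⟨x.2, (hker _ _).2 (h.proj_snd_eq_zero hx), congrArg Prod.snd hxy⟩
  · intro i k x
    have h1 := h.stable i k (0, x)
    rw [levelProd_prodMap, hnorm] at h1
    exact (_root_.norm_snd_le _).trans h1
  · intro i k x hx
    have h1 := h.unstable i k (0, x) ((hker _ _).1 hx)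
    rwa [hprod, hnorm, hnorm] at h1

end LevelDichotomy

end Diagonal

section Triangular

variable {E₁ E₂ : Type*} [NormedAddCommGroup E₁] [NormedSpace ℝ E₁]
  [NormedAddCommGroup E₂] [NormedSpace ℝ E₂]

/-- The upper triangular operators `(x₁, x₂) ↦ (A₁ i x₁ + B i x₂, A₂ i x₂)`. -/
def levelTriangular (A₁ : ℕ → E₁ →L[ℝ] E₁) (B : ℕ → E₂ →L[ℝ] E₁) (A₂ : ℕ → E₂ →L[ℝ] E₂)
    (i : ℕ) : (E₁ × E₂) →L[ℝ] E₁ × E₂ :=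
  ((A₁ i).comp (ContinuousLinearMap.fst ℝ E₁ E₂)
    + (B i).comp (ContinuousLinearMap.snd ℝ E₁ E₂)).prod
    ((A₂ i).comp (ContinuousLinearMap.snd ℝ E₁ E₂))

lemma levelTriangular_apply (A₁ : ℕ → E₁ →L[ℝ] E₁) (B : ℕ → E₂ →L[ℝ] E₁)
    (A₂ : ℕ → E₂ →L[ℝ] E₂) (i : ℕ) (x : E₁ × E₂) :
    levelTriangular A₁ B A₂ i x = (A₁ i x.1 + B i x.2, A₂ i x.2) := rfl

lemma levelProd_levelTriangular_snd (A₁ : ℕ → E₁ →L[ℝ] E₁) (B : ℕ → E₂ →L[ℝ] E₁)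
    (A₂ : ℕ → E₂ →L[ℝ] E₂) (i k : ℕ) (x : E₁ × E₂) :
    (levelProd (levelTriangular A₁ B A₂) i k x).2 = levelProd A₂ i k x.2 := by
  induction k generalizing i with
  | zero => rfl
  | succ k ih => rw [levelProd_succ, levelTriangular_apply, ih, levelProd_succ]

variable {A₁ : ℕ → E₁ →L[ℝ] E₁} {B : ℕ → E₂ →L[ℝ] E₁} {A₂ : ℕ → E₂ →L[ℝ] E₂}
  {P₁ : ℕ → E₁ →L[ℝ] E₁} {P₂ : ℕ → E₂ →L[ℝ] E₂} {K r c s : ℝ}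

/-- One step of a convolution estimate with two different geometric rates. -/
lemma geometric_step {K r s c : ℝ} (hK : 0 < K) (hr : 0 < r) (hrs : r < s) (hc : 0 ≤ c)
    (k l : ℕ) {N : ℝ} (hN : 0 ≤ N) :
    (K + K * K * c / (s - r)) * r ^ (l + 1) * s ^ k * N + K * K * c * r ^ (l + k) * N
      ≤ (K + K * K * c / (s - r)) * r ^ l * s ^ (k + 1) * N := by
  have hsr : 0 < s - r := sub_pos.2 hrs
  have hd : K * K * c / (s - r) * (s - r) = K * K * c := div_mul_cancel₀ _ hsr.ne'
  have hpow : r ^ k ≤ s ^ k := pow_le_pow_left₀ hr.le hrs.le k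
  have h1 : 0 ≤ K * (s - r) * s ^ k := by have := hr.trans hrs; positivity
  have h2 : K * K * c * r ^ k ≤ K * K * c * s ^ k := by gcongr
  have h3 : (K + K * K * c / (s - r)) * r * s ^ k + K * K * c * r ^ k
      ≤ (K + K * K * c / (s - r)) * s * s ^ k := by
    have : (K + K * K * c / (s - r)) * s * s ^ k
        = (K + K * K * c / (s - r)) * r * s ^ k + K * (s - r) * s ^ k
          + (K * K * c / (s - r) * (s - r)) * s ^ k := by ring
    rw [this, hd]
    linarith
  calc _ = r ^ l * N * ((K + K * K * c / (s - r)) * r * s ^ k + K * K * c * r ^ k) := by ring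
    _ ≤ r ^ l * N * ((K + K * K * c / (s - r)) * s * s ^ k) := by gcongr
    _ = _ := by ring

/-- A triangular system has a dichotomy if its off-diagonal part intertwines the
projections of the two diagonal blocks. -/
lemma LevelDichotomy.triangular_of_comm (h₁ : LevelDichotomy A₁ P₁ K r)
    (h₂ : LevelDichotomy A₂ P₂ K r) (hc : 0 ≤ c) (hB : ∀ i x, ‖B i x‖ ≤ c * ‖x‖)
    (hcomm : ∀ i x, P₁ i (B i x) = B i (P₂ (i + 1) x)) (hrs : r < s) (hs : s < 1) :
    ∃ K', LevelDichotomy (levelTriangular A₁ B A₂) (fun i => (P₁ i).prodMap (P₂ i)) K' s := by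
  have hK := h₁.K_pos
  have hr := h₁.r_pos
  have hs0 := hr.trans hrs
  have hsr : 0 < s - r := sub_pos.2 hrs
  set C := K + K * K * c / (s - r) with hC
  have hC0 : 0 < C := by positivity
  have hKC : K ≤ C := by rw [hC]; linarith [show 0 ≤ K * K * c / (s - r) by positivity]
  have hTcomm : ∀ i (x : E₁ × E₂), levelTriangular A₁ B A₂ i (P₁ (i + 1) x.1, P₂ (i + 1) x.2)
      = (P₁ i (levelTriangular A₁ B A₂ i x).1, P₂ i (levelTriangular A₁ B A₂ i x).2) := by
    intro i x
    simp [levelTriangular_apply, h₁.comm, h₂.comm, hcomm]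
  have hfwd : ∀ k i l (x : E₁ × E₂), P₁ (i + l + k) x.1 = x.1 → P₂ (i + l + k) x.2 = x.2 →
      ‖levelProd A₁ i l (levelProd (levelTriangular A₁ B A₂) (i + l) k x).1‖
        ≤ C * r ^ l * s ^ k * ‖x‖ := by
    intro k
    induction k with
    | zero =>
      intro i l x hx₁ hx₂
      have := h₁.stable i l x.1
      rw [show P₁ (i + l) x.1 = x.1 from hx₁] at this
      refine this.trans ?_
      rw [pow_zero, mul_one]
      gcongr
      exact norm_fst_le x
    | succ k ih =>
      intro i l x hx₁ hx₂
      have e : i + (l + 1) + k = i + l + (k + 1) := by omega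
      have h1 := ih i (l + 1) x (by rwa [e]) (by rwa [e])
      rw [levelProd_succ'] at h1
      set y := levelProd A₂ (i + l + 1) k x.2 with hy
      have hy2 : P₂ (i + l + 1) y = y := by
        rw [hy, ← h₂.levelProd_comm, show i + l + 1 + k = i + l + (k + 1) by omega, hx₂]
      have hyn : ‖y‖ ≤ K * r ^ k * ‖x‖ := by
        have := h₂.stable (i + l + 1) k x.2
        rw [show i + l + 1 + k = i + l + (k + 1) by omega, hx₂] at this
        refine this.trans ?_
        gcongr
        exact norm_snd_le x
      have h2 : ‖levelProd A₁ i l (B (i + l) y)‖ ≤ K * K * c * r ^ (l + k) * ‖x‖ := by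
        have := h₁.stable i l (B (i + l) y)
        rw [hcomm, hy2] at this
        calc _ ≤ K * r ^ l * ‖B (i + l) y‖ := this
          _ ≤ K * r ^ l * (c * (K * r ^ k * ‖x‖)) := by
            gcongr
            refine (hB _ _).trans ?_
            gcongr
          _ = _ := by ring
      rw [levelProd_succ, levelTriangular_apply, levelProd_levelTriangular_snd, ← hy, map_add]
      exact (norm_add_le _ _).trans ((add_le_add h1 h2).trans
        (geometric_step hK hr hrs hc k l (norm_nonneg x)))
  have hbwd : ∀ k i l (x : E₁ × E₂) (z : E₁), P₁ (i + k) x.1 = 0 → P₂ (i + k) x.2 = 0 →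
      P₁ (i + k + l) z = 0 → levelProd A₁ (i + k) l z = x.1 →
      ‖z‖ ≤ C * r ^ l * s ^ k * ‖levelProd (levelTriangular A₁ B A₂) i k x‖ := by
    intro k
    induction k with
    | zero =>
      intro i l x z hx₁ hx₂ hz hzx
      have := h₁.unstable i l z hz
      rw [show levelProd A₁ i l z = x.1 from hzx] at this
      refine this.trans ?_
      rw [pow_zero, mul_one, levelProd_zero]
      gcongr
      exact norm_fst_le x
    | succ k ih =>
      intro i l x z hx₁ hx₂ hz hzx
      set N := ‖levelProd (levelTriangular A₁ B A₂) i (k + 1) x‖ with hN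
      have e : i + k + (l + 1) = i + (k + 1) + l := by omega
      have hBx : P₁ (i + k) (B (i + k) x.2) = 0 := by
        rw [hcomm, show P₂ (i + k + 1) x.2 = 0 from hx₂, map_zero]
      obtain ⟨w, hw, hwx⟩ := h₁.levelProd_surj (i + k) (l + 1) _ hBx
      have hx2n : ‖x.2‖ ≤ K * r ^ (k + 1) * N := by
        refine (h₂.unstable i (k + 1) x.2 hx₂).trans ?_
        rw [← levelProd_levelTriangular_snd A₁ B A₂]
        gcongr
        exact norm_snd_le _
      have hwn : ‖w‖ ≤ K * K * c * r ^ (l + k) * N := by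
        have hr1 : r * r ≤ 1 := by nlinarith [h₁.r_lt_one]
        calc ‖w‖ ≤ K * r ^ (l + 1) * ‖B (i + k) x.2‖ := hwx ▸ h₁.unstable _ _ w hw
          _ ≤ K * r ^ (l + 1) * (c * (K * r ^ (k + 1) * N)) := by
            gcongr
            refine (hB _ _).trans ?_
            gcongr
          _ = r * r * (K * K * c * r ^ (l + k) * N) := by ring
          _ ≤ 1 * (K * K * c * r ^ (l + k) * N) := by gcongr
          _ = _ := one_mul _
      have hTx := hTcomm (i + k) x
      rw [show P₁ (i + k + 1) x.1 = 0 from hx₁, show P₂ (i + k + 1) x.2 = 0 from hx₂,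
        show ((0, 0) : E₁ × E₂) = 0 from rfl, map_zero, eq_comm, Prod.mk_eq_zero] at hTx
      have h1 := ih i (l + 1) (levelTriangular A₁ B A₂ (i + k) x) (z + w) hTx.1 hTx.2
        (by rw [map_add, hw, e, hz, add_zero])
        (by
          rw [map_add, hwx, levelProd_succ, show levelProd A₁ (i + k + 1) l z = x.1 from hzx]
          rfl)
      rw [← levelProd_succ', ← hN] at h1
      calc ‖z‖ = ‖z + w - w‖ := by rw [add_sub_cancel_right]
        _ ≤ ‖z + w‖ + ‖w‖ := norm_sub_le _ _
        _ ≤ _ := (add_le_add h1 hwn).trans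
          (geometric_step hK hr hrs hc k l (norm_nonneg _))
  refine ⟨C * (1 + K), by positivity, hs0, hs, ?_, ?_, ?_, ?_, ?_⟩
  · intro i x
    exact Prod.ext (h₁.idem i x.1) (h₂.idem i x.2)
  · exact hTcomm
  · intro i y hy
    have hy₁ : P₁ i y.1 = 0 := congrArg Prod.fst hy
    have hy₂ : P₂ i y.2 = 0 := congrArg Prod.snd hy
    obtain ⟨x₂, hx₂, hxy₂⟩ := h₂.surj i y.2 hy₂
    obtain ⟨x₁, hx₁, hxy₁⟩ := h₁.surj i (y.1 - B i x₂)
      (by rw [map_sub, hcomm, hx₂, map_zero, hy₁, sub_zero])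
    refine ⟨(x₁, x₂), Prod.mk_eq_zero.2 ⟨hx₁, hx₂⟩, ?_⟩
    simp [levelTriangular_apply, hxy₁, hxy₂]
  · intro i k x
    have hpow : r ^ k ≤ s ^ k := pow_le_pow_left₀ hr.le hrs.le k
    set y : E₁ × E₂ := (P₁ (i + k) x.1, P₂ (i + k) x.2) with hy
    have hyn : ‖y‖ ≤ (1 + K) * ‖x‖ := by
      have : K * ‖x‖ ≤ (1 + K) * ‖x‖ := by gcongr; linarith
      refine le_trans (max_le ?_ ?_) this
      · exact (h₁.norm_proj_le _ _).trans (by gcongr; exact norm_fst_le x)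
      · exact (h₂.norm_proj_le _ _).trans (by gcongr; exact norm_snd_le x)
    have h1 := hfwd k i 0 y (h₁.idem _ _) (h₂.idem _ _)
    rw [levelProd_zero, pow_zero, mul_one, add_zero] at h1
    have h2 : ‖(levelProd (levelTriangular A₁ B A₂) i k y).2‖ ≤ C * s ^ k * ‖y‖ := by
      have := h₂.stable i k y.2
      rw [show P₂ (i + k) y.2 = y.2 from h₂.idem _ _] at this
      rw [levelProd_levelTriangular_snd]
      refine this.trans ?_
      gcongr
      exact norm_snd_le y
    calc ‖levelProd (levelTriangular A₁ B A₂) i k y‖ ≤ C * s ^ k * ‖y‖ := max_le h1 h2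
      _ ≤ C * s ^ k * ((1 + K) * ‖x‖) := by gcongr
      _ = _ := by ring
  · intro i k x hx
    have hpow : r ^ k ≤ s ^ k := pow_le_pow_left₀ hr.le hrs.le k
    have hx₁ : P₁ (i + k) x.1 = 0 := congrArg Prod.fst hx
    have hx₂ : P₂ (i + k) x.2 = 0 := congrArg Prod.snd hx
    have h1 := hbwd k i 0 x x.1 hx₁ hx₂ hx₁ rfl
    rw [pow_zero, mul_one] at h1
    have h2 : ‖x.2‖ ≤ C * s ^ k * ‖levelProd (levelTriangular A₁ B A₂) i k x‖ := by
      refine (h₂.unstable i k x.2 hx₂).trans ?_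
      rw [← levelProd_levelTriangular_snd A₁ B A₂]
      gcongr
      exact norm_snd_le _
    refine (max_le h1 h2).trans ?_
    gcongr
    nlinarith

/-- The bounded solution of the homological equation for the stable-unstable corner. -/
lemma LevelDichotomy.exists_stable_unstable_solution [CompleteSpace E₁]
    (h₁ : LevelDichotomy A₁ P₁ K r) (h₂ : LevelDichotomy A₂ P₂ K r) (hc : 0 ≤ c)
    (hB : ∀ i x, ‖B i x‖ ≤ c * ‖x‖) :
    ∃ (L : ℕ → E₂ →L[ℝ] E₁) (C : ℝ), 0 ≤ C ∧ (∀ i x, ‖L i x‖ ≤ C * ‖x‖) ∧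
      ∀ i x, L i (A₂ i x) - A₁ i (L (i + 1) x) = P₁ i (B i (x - P₂ (i + 1) x)) := by
  have hK := h₁.K_pos
  have hr := h₁.r_pos
  have hr1 := h₁.r_lt_one
  obtain ⟨G, hGP, hGl, hGn⟩ := h₂.exists_unstable_inverse
  obtain ⟨F, hF⟩ : ∃ F : ℕ → ℕ → E₂ →L[ℝ] E₁, ∀ i j x,
      F i j x = levelProd A₁ i j (P₁ (i + j) (B (i + j) (G i (j + 1) x))) :=
    ⟨fun i j => (levelProd A₁ i j).comp
      ((P₁ (i + j)).comp ((B (i + j)).comp (G i (j + 1)))), fun _ _ _ => rfl⟩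
  set D := K * c * (K * (1 + K)) with hD
  have hD0 : 0 ≤ D := by positivity
  have hFn : ∀ i j, ‖F i j‖ ≤ D * r ^ j := by
    intro i j
    refine ContinuousLinearMap.opNorm_le_bound _ (by positivity) fun x => ?_
    have hp : r ^ j * r ^ (j + 1) ≤ 1 * r ^ j := by
      rw [mul_comm]
      gcongr
      exact pow_le_one₀ hr.le hr1.le
    calc ‖F i j x‖ ≤ K * r ^ j * ‖B (i + j) (G i (j + 1) x)‖ := by
          rw [hF]
          exact h₁.stable _ _ _
      _ ≤ K * r ^ j * (c * (K * (1 + K) * r ^ (j + 1) * ‖x‖)) := by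
        gcongr
        refine (hB _ _).trans ?_
        gcongr
        exact hGn _ _ _
      _ = D * ‖x‖ * (r ^ j * r ^ (j + 1)) := by rw [hD]; ring
      _ ≤ D * ‖x‖ * (1 * r ^ j) := by gcongr
      _ = _ := by ring
  have hgeo : Summable fun j : ℕ => D * r ^ j :=
    (summable_geometric_of_lt_one hr.le hr1).mul_left D
  have hsum : ∀ i, Summable (F i) := fun i => Summable.of_norm_bounded hgeo (hFn i)
  have happ : ∀ i x, HasSum (fun j => F i j x) ((∑' j, F i j) x) := fun i x =>
    (ContinuousLinearMap.apply ℝ E₁ x).hasSum (hsum i).hasSum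
  have hGA : ∀ i j x, G i (j + 1) (A₂ i x) = G (i + 1) j x := by
    intro i j x
    have e : i + (j + 1) = i + 1 + j := by omega
    refine h₂.eq_of_levelProd_eq i (j + 1) (hGP _ _ _) (by rw [e, hGP]) ?_
    rw [hGl, levelProd_succ, hGl, map_sub, h₂.comm]
  have hG0 : ∀ i x, G i 0 x = x - P₂ i x := fun i x => hGl i 0 x
  refine ⟨fun i => ∑' j, F i j, D * (1 - r)⁻¹, ?_, ?_, ?_⟩
  · have : 0 < 1 - r := sub_pos.2 hr1
    positivity
  · intro i x
    refine ContinuousLinearMap.le_of_opNorm_le _ ?_ x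
    refine tsum_of_norm_bounded ?_ (hFn i)
    exact (hasSum_geometric_of_lt_one hr.le hr1).mul_left D
  · intro i x
    have hFs : ∀ j, F i (j + 1) (A₂ i x) = A₁ i (F (i + 1) j x) := by
      intro j
      have e : i + (j + 1) = i + 1 + j := by omega
      rw [hF, hF, hGA, levelProd_succ, e]
    have h1 : HasSum (fun j => F i (j + 1) (A₂ i x)) (A₁ i ((∑' j, F (i + 1) j) x)) := by
      simp only [hFs]
      exact (A₁ i).hasSum (happ (i + 1) x)
    have h2 := (happ i (A₂ i x)).unique ((hasSum_nat_add_iff 1).1 h1)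
    have h3 : F i 0 (A₂ i x) = P₁ i (B i (x - P₂ (i + 1) x)) := by
      rw [← hG0, ← hGA, hF]
      rfl
    rw [h2, Finset.sum_range_one, h3]
    abel

/-- The bounded solution of the homological equation for the unstable-stable corner. -/
lemma LevelDichotomy.exists_unstable_stable_solution
    (h₁ : LevelDichotomy A₁ P₁ K r) (h₂ : LevelDichotomy A₂ P₂ K r) (hc : 0 ≤ c)
    (hB : ∀ i x, ‖B i x‖ ≤ c * ‖x‖) :
    ∃ (M : ℕ → E₂ →L[ℝ] E₁) (C : ℝ), 0 ≤ C ∧ (∀ i x, ‖M i x‖ ≤ C * ‖x‖) ∧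
      ∀ i x, M i (A₂ i x) - A₁ i (M (i + 1) x)
        = B i (P₂ (i + 1) x) - P₁ i (B i (P₂ (i + 1) x)) := by
  have hK := h₁.K_pos
  have hr := h₁.r_pos
  have hr1 := h₁.r_lt_one
  obtain ⟨G, hGP, hGl, hGn⟩ := h₁.exists_unstable_inverse
  let M : ℕ → E₂ →L[ℝ] E₁ := fun i => Nat.rec 0
    (fun i m => (G i 1).comp ((m.comp (A₂ i) - B i).comp (P₂ (i + 1)))) i
  have hM0 : ∀ x, M 0 x = 0 := fun _ => rfl
  have hMs : ∀ i x, M (i + 1) x = G i 1 (M i (A₂ i (P₂ (i + 1) x)) - B i (P₂ (i + 1) x)) :=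
    fun _ _ => rfl
  have hMP₂ : ∀ i x, M i (P₂ i x) = M i x := by
    rintro (_ | i) x
    · rw [hM0, hM0]
    · rw [hMs, hMs, h₂.idem]
  have hP₁M : ∀ i x, P₁ i (M i x) = 0 := by
    rintro (_ | i) x
    · rw [hM0, map_zero]
    · rw [hMs]
      exact hGP i 1 _
  have hGG : ∀ i k y, G (i + 1) k (G i 1 y) = G i (k + 1) y := by
    intro i k y
    have e : i + (k + 1) = i + 1 + k := by omega
    refine h₁.eq_of_levelProd_eq i (k + 1) (by rw [e, hGP]) (hGP _ _ _) ?_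
    rw [levelProd_succ, hGl, hGl, map_sub, h₁.comm, show A₁ i (G i 1 y) = y - P₁ i y from hGl i 1 y,
      h₁.proj_sub_proj, sub_zero]
  set D := K * (1 + K) * c * K with hD
  have hD0 : 0 ≤ D := by positivity
  have h1r : 0 < 1 - r := sub_pos.2 hr1
  have hstep : ∀ k, D / (1 - r) * r ^ (k + 1) + D * r ^ k ≤ D / (1 - r) * r ^ k := by
    intro k
    have : D / (1 - r) * (1 - r) = D := div_mul_cancel₀ _ h1r.ne'
    have h2 : D / (1 - r) * r ^ k = D / (1 - r) * r ^ (k + 1) + D / (1 - r) * (1 - r) * r ^ k := by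
      ring
    rw [h2, this]
  have hbound : ∀ i k x, ‖G i k (M i (levelProd A₂ i k (P₂ (i + k) x)))‖
      ≤ D / (1 - r) * r ^ k * ‖x‖ := by
    intro i
    induction i with
    | zero =>
      intro k x
      rw [hM0, map_zero, norm_zero]
      positivity
    | succ i ih =>
      intro k x
      have e : i + 1 + k = i + (k + 1) := by omega
      have h1 := ih (k + 1) x
      rw [hMs, hGG, h₂.levelProd_comm, h₂.idem, ← h₂.levelProd_comm, ← levelProd_succ, map_sub, e]
      have h3 : ‖G i (k + 1) (B i (levelProd A₂ (i + 1) k (P₂ (i + (k + 1)) x)))‖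
          ≤ D * r ^ k * ‖x‖ := by
        have h4 := h₂.stable (i + 1) k x
        rw [e] at h4
        have hp : r ^ (k + 1) * r ^ k ≤ 1 * r ^ k := by
          gcongr
          exact pow_le_one₀ hr.le hr1.le
        calc _ ≤ K * (1 + K) * r ^ (k + 1) * (c * (K * r ^ k * ‖x‖)) := by
              refine (hGn _ _ _).trans ?_
              gcongr
              refine (hB _ _).trans ?_
              gcongr
          _ = D * ‖x‖ * (r ^ (k + 1) * r ^ k) := by rw [hD]; ring
          _ ≤ D * ‖x‖ * (1 * r ^ k) := by gcongr
          _ = _ := by ring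
      calc _ ≤ D / (1 - r) * r ^ (k + 1) * ‖x‖ + D * r ^ k * ‖x‖ :=
            (norm_sub_le _ _).trans (add_le_add h1 h3)
        _ = (D / (1 - r) * r ^ (k + 1) + D * r ^ k) * ‖x‖ := by ring
        _ ≤ _ := by
          gcongr
          exact hstep k
  refine ⟨M, D / (1 - r), by positivity, ?_, ?_⟩
  · intro i x
    have := hbound i 0 x
    rw [levelProd_zero, add_zero, hMP₂, show G i 0 (M i x) = M i x - P₁ i (M i x) from hGl i 0 _,
      hP₁M, sub_zero, pow_zero, mul_one] at this
    exact this
  · intro i x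
    rw [hMs, show ∀ y, A₁ i (G i 1 y) = y - P₁ i y from hGl i 1, map_sub, hP₁M, h₂.comm, hMP₂]
    abel

/-- A triangular system with bounded off-diagonal part inherits the dichotomies of its
diagonal blocks. -/
lemma LevelDichotomy.triangular [CompleteSpace E₁] (h₁ : LevelDichotomy A₁ P₁ K r)
    (h₂ : LevelDichotomy A₂ P₂ K r) (hc : 0 ≤ c) (hB : ∀ i x, ‖B i x‖ ≤ c * ‖x‖) :
    ∃ P K' s, LevelDichotomy (levelTriangular A₁ B A₂) P K' s := by
  have hK := h₁.K_pos
  obtain ⟨L, C, hC, hL, hLeq⟩ := h₁.exists_stable_unstable_solution h₂ hc hB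
  obtain ⟨M, C', hC', hM, hMeq⟩ := h₁.exists_unstable_stable_solution h₂ hc hB
  set S : ℕ → E₂ →L[ℝ] E₁ := fun i => L i + M i with hS
  have hSn : ∀ i x, ‖S i x‖ ≤ (C + C') * ‖x‖ := by
    intro i x
    rw [add_mul]
    exact (norm_add_le _ _).trans (add_le_add (hL i x) (hM i x))
  -- The part of the off-diagonal term that intertwines the projections.
  set B' : ℕ → E₂ →L[ℝ] E₁ := fun i => B i + (A₁ i).comp (S (i + 1)) - (S i).comp (A₂ i) with hB'
  have hB'eq : ∀ i x, B' i x = P₁ i (B i (P₂ (i + 1) x))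
      + (B i (x - P₂ (i + 1) x) - P₁ i (B i (x - P₂ (i + 1) x))) := by
    intro i x
    have h1 : B' i x = B i x - (L i (A₂ i x) - A₁ i (L (i + 1) x))
        - (M i (A₂ i x) - A₁ i (M (i + 1) x)) := by
      simp only [hB', hS, sub_apply, add_apply,
        ContinuousLinearMap.comp_apply, map_add]
      abel
    rw [h1, hLeq, hMeq, map_sub (B i)]
    abel
  have hB'comm : ∀ i x, P₁ i (B' i x) = B' i (P₂ (i + 1) x) := by
    intro i x
    rw [hB'eq, hB'eq, h₂.idem, sub_self, map_zero, map_zero, sub_zero, add_zero, map_add, h₁.idem,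
      h₁.proj_sub_proj, add_zero]
  have hB'n : ∀ i x, ‖B' i x‖ ≤ (K * (c * K) + (1 + K) * (c * (1 + K))) * ‖x‖ := by
    intro i x
    rw [hB'eq, add_mul]
    refine (norm_add_le _ _).trans (add_le_add ?_ ?_)
    · calc _ ≤ K * (c * (K * ‖x‖)) := by
            refine (h₁.norm_proj_le _ _).trans ?_
            gcongr
            refine (hB _ _).trans ?_
            gcongr
            exact h₂.norm_proj_le _ _
        _ = _ := by ring
    · calc _ ≤ (1 + K) * (c * ((1 + K) * ‖x‖)) := by
            refine (h₁.norm_sub_proj_le _ _).trans ?_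
            gcongr
            refine (hB _ _).trans ?_
            gcongr
            exact h₂.norm_sub_proj_le _ _
        _ = _ := by ring
  obtain ⟨s, hrs, hs⟩ := exists_between h₁.r_lt_one
  obtain ⟨K', h⟩ := h₁.triangular_of_comm h₂ (by positivity) hB'n hB'comm hrs hs
  have hid : ∀ (V : ℕ → E₂ →L[ℝ] E₁), (∀ i x, ‖V i x‖ ≤ (C + C') * ‖x‖) → ∀ i (x : E₁ × E₂),
      ‖levelTriangular (fun _ => ContinuousLinearMap.id ℝ E₁) V
        (fun _ => ContinuousLinearMap.id ℝ E₂) i x‖ ≤ (1 + (C + C')) * ‖x‖ := by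
    intro V hV i x
    refine max_le ?_ ?_
    · calc ‖x.1 + V i x.2‖ ≤ ‖x‖ + (C + C') * ‖x‖ := by
            refine (norm_add_le _ _).trans (add_le_add (_root_.norm_fst_le x) ?_)
            refine (hV _ _).trans ?_
            gcongr
            exact _root_.norm_snd_le x
        _ = _ := by ring
    · calc ‖x.2‖ ≤ 1 * ‖x‖ := by rw [one_mul]; exact _root_.norm_snd_le x
        _ ≤ _ := by gcongr; linarith
  refine ⟨_, _, s, h.conj (τ := 1 + (C + C')) (by positivity)
    (T := levelTriangular (fun _ => ContinuousLinearMap.id ℝ E₁) S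
      (fun _ => ContinuousLinearMap.id ℝ E₂))
    (T' := levelTriangular (fun _ => ContinuousLinearMap.id ℝ E₁) (fun i => -S i)
      (fun _ => ContinuousLinearMap.id ℝ E₂)) ?_ ?_ (hid S hSn)
    (hid _ fun i x => by simpa using hSn i x) ?_⟩
  · intro i x
    simp [levelTriangular_apply]
  · intro i x
    simp [levelTriangular_apply]
  · intro i x
    refine Prod.ext ?_ rfl
    simp only [levelTriangular_apply, hB', sub_apply,
      add_apply, ContinuousLinearMap.comp_apply,
      ContinuousLinearMap.id_apply, map_add]
    abel

end Triangular

theorem triangular_dichotomy_of_diagonal_Zminus {H1 : Type u} {H2 : Type u}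
    [NormedAddCommGroup H1] [InnerProductSpace ℝ H1] [CompleteSpace H1]
    [NormedAddCommGroup H2] [InnerProductSpace ℝ H2] [CompleteSpace H2]
    (A11 : ℤ → H1 →L[ℝ] H1) (A12 : ℤ → H2 →L[ℝ] H1) (A22 : ℤ → H2 →L[ℝ] H2)
    (hdiag : ExpDichotomy {n : ℤ | n ≤ 0} {n : ℤ | n ≤ -1} (diagonal A11 A22))
    (hbdd : ∃ C : ℝ, ∀ n : ℤ, n ≤ -1 → ‖A12 n‖ ≤ C) :
    ExpDichotomy {n : ℤ | n ≤ 0} {n : ℤ | n ≤ -1} (triangular A11 A12 A22) := by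
  obtain ⟨P, hP⟩ := hdiag
  obtain ⟨K, r, h⟩ := hP.levelDichotomy
  obtain ⟨C, hC⟩ := hbdd
  have h₁ := h.fst
  have h₂ := h.snd
  have hB : ∀ (i : ℕ) (x : H2), ‖A12 (-((i + 1 : ℕ) : ℤ)) x‖ ≤ max C 0 * ‖x‖ := fun i x =>
    ContinuousLinearMap.le_of_opNorm_le _
      ((hC _ (by push_cast; omega)).trans (le_max_left _ _)) x
  obtain ⟨Q, K', s, hQ⟩ := h₁.triangular (B := fun i : ℕ => A12 (-((i + 1 : ℕ) : ℤ))) h₂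
    (le_max_right C 0) hB
  exact LevelDichotomy.expDichotomy (A := triangular A11 A12 A22) hQ

end
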